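/- arXiv:2603.05395 — 2 statements merged into one kernel-verified Lean document; each statement's English description precedes it below -/
import Mathlib

section
/- Let G be a simple graph on a finite vertex type V such that every vertex has positive degree, let A be its adjacency matrix over ℝ and D the diagonal matrix of degrees. Define the normalized Laplacian Δ_G = 1 - D^{-1/2} * A * D^{-1/2}, where D^{-1/2} is the diagonal matrix with entries (deg u)^{-1/2}. Then for x : V → ℝ, Δ_G *ᵥ x = 0 if and only if for all vertices u, v with G.Reachable u v, x u / Real.sqrt (deg u) = x v / Real.sqrt (deg v). -/
open Matrix

/-- Each coordinate of the normalized Laplacian applied to `x` is a rescaled coordinate of the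
combinatorial Laplacian applied to `x u / √(deg u)`. -/
theorem normalizedLaplacian_mulVec_apply
    {V : Type*} [Fintype V] [DecidableEq V] (G : SimpleGraph V) [DecidableRel G.Adj]
    (x : V → ℝ) {u : V} (hu : 0 < G.degree u) :
    ((1 : Matrix V V ℝ) -
        Matrix.diagonal (fun u : V => (Real.sqrt (G.degree u))⁻¹) * G.adjMatrix ℝ *
          Matrix.diagonal (fun u : V => (Real.sqrt (G.degree u))⁻¹)).mulVec x u =
      (Real.sqrt (G.degree u))⁻¹ *
        (G.lapMatrix ℝ).mulVec (fun v => x v / Real.sqrt (G.degree v)) u := by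
  have hd : (0 : ℝ) < G.degree u := by exact_mod_cast hu
  have hs : Real.sqrt (G.degree u) ≠ 0 := (Real.sqrt_pos.2 hd).ne'
  have hx : (Real.sqrt (G.degree u))⁻¹ * (G.degree u * (x u / Real.sqrt (G.degree u))) = x u := by
    field_simp
    rw [Real.sq_sqrt hd.le]
  rw [SimpleGraph.lapMatrix_mulVec_apply, mul_sub, hx, Matrix.sub_mulVec, Matrix.one_mulVec,
    Pi.sub_apply, ← Matrix.mulVec_mulVec, ← Matrix.mulVec_mulVec, Matrix.mulVec_diagonal,
    SimpleGraph.adjMatrix_mulVec_apply]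
  simp only [Matrix.mulVec_diagonal, div_eq_inv_mul]

/-- Kernel characterization of the symmetric normalized graph Laplacian
`Δ_G = 1 - D^{-1/2} A D^{-1/2}` for a graph in which every vertex has positive degree:
`Δ_G *ᵥ x = 0` iff `x u / √(deg u)` is constant on each connected component. -/
theorem normalizedLaplacian_kernel_iff
    {V : Type*} [Fintype V] [DecidableEq V] (G : SimpleGraph V) [DecidableRel G.Adj]
    (hdeg : ∀ u : V, 0 < G.degree u) (x : V → ℝ) :
    ((1 : Matrix V V ℝ) -
        Matrix.diagonal (fun u : V => (Real.sqrt (G.degree u))⁻¹) * G.adjMatrix ℝ *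
          Matrix.diagonal (fun u : V => (Real.sqrt (G.degree u))⁻¹)).mulVec x = 0 ↔
      ∀ u v : V, G.Reachable u v →
        x u / Real.sqrt (G.degree u) = x v / Real.sqrt (G.degree v) := by
  rw [← G.lapMatrix_mulVec_eq_zero_iff_forall_reachable
    (x := fun v => x v / Real.sqrt (G.degree v)), funext_iff, funext_iff]
  refine forall_congr' fun u => ?_
  have hs : Real.sqrt (G.degree u) ≠ 0 := (Real.sqrt_pos.2 (by exact_mod_cast hdeg u)).ne'
  rw [normalizedLaplacian_mulVec_apply G x (hdeg u), Pi.zero_apply, mul_eq_zero,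
    or_iff_right (inv_ne_zero hs)]
end

section
/- Let G be a simple graph on a finite linearly ordered vertex type V, let d be a natural number, and for each edge e = {u,v} of G with u < v let F e u and F e v be matrices in Matrix (Fin d) (Fin d) ℝ. Let δ be the coboundary matrix and Δ_F = δᵀ * δ the sheaf Laplacian. Then for every x : V × Fin d → ℝ, Δ_F *ᵥ x = 0 if and only if for every edge e = {u,v} of G (with u < v), (F e u) *ᵥ (fun i => x (u, i)) = (F e v) *ᵥ (fun i => x (v, i)). -/
open Matrix

/-- The coboundary matrix `δ` of a cellular sheaf on `G` with `d`-dimensional stalks and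
restriction maps `F e u : Matrix (Fin d) (Fin d) ℝ`, using the orientation of each edge
`e = {u, v}` given by `u < v` (i.e. from `e.inf` to `e.sup`): for `x : V × Fin d → ℝ`,
`(δ *ᵥ x)` at edge `e` equals `(F e u) *ᵥ (x u ·) - (F e v) *ᵥ (x v ·)`. -/
def coboundary {V : Type*} [Fintype V] [LinearOrder V]
    (G : SimpleGraph V) [DecidableRel G.Adj] (d : ℕ)
    (F : Sym2 V → V → Matrix (Fin d) (Fin d) ℝ) :
    Matrix (G.edgeSet × Fin d) (V × Fin d) ℝ :=
  fun p q =>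
    (if q.1 = (p.1 : Sym2 V).inf then F p.1 (p.1 : Sym2 V).inf p.2 q.2 else 0) -
      (if q.1 = (p.1 : Sym2 V).sup then F p.1 (p.1 : Sym2 V).sup p.2 q.2 else 0)

/-- The sheaf Laplacian `Δ_F = δᵀ * δ`. -/
def sheafLaplacian {V : Type*} [Fintype V] [LinearOrder V]
    (G : SimpleGraph V) [DecidableRel G.Adj] (d : ℕ)
    (F : Sym2 V → V → Matrix (Fin d) (Fin d) ℝ) :
    Matrix (V × Fin d) (V × Fin d) ℝ :=
  (coboundary G d F)ᵀ * coboundary G d F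


theorem coboundary_mulVec_apply {V : Type*} [Fintype V] [LinearOrder V]
    (G : SimpleGraph V) [DecidableRel G.Adj] (d : ℕ)
    (F : Sym2 V → V → Matrix (Fin d) (Fin d) ℝ) (x : V × Fin d → ℝ) (e : G.edgeSet) (i : Fin d) :
    (coboundary G d F *ᵥ x) (e, i) =
      (F e (e : Sym2 V).inf *ᵥ fun j => x ((e : Sym2 V).inf, j)) i -
        (F e (e : Sym2 V).sup *ᵥ fun j => x ((e : Sym2 V).sup, j)) i := by
  simp only [coboundary, mulVec, dotProduct, sub_mul, ite_mul, zero_mul, Finset.sum_sub_distrib,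
    Fintype.sum_prod_type_right, Finset.sum_ite_eq', Finset.mem_univ, if_true]

theorem coboundary_mulVec_eq_zero_iff {V : Type*} [Fintype V] [LinearOrder V]
    (G : SimpleGraph V) [DecidableRel G.Adj] (d : ℕ)
    (F : Sym2 V → V → Matrix (Fin d) (Fin d) ℝ) (x : V × Fin d → ℝ) :
    coboundary G d F *ᵥ x = 0 ↔
      ∀ u v : V, G.Adj u v → u < v →
        F s(u, v) u *ᵥ (fun i => x (u, i)) = F s(u, v) v *ᵥ fun i => x (v, i) := by
  constructor
  · intro h u v huv hlt
    funext i
    have hi := congrFun h (⟨s(u, v), huv⟩, i)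
    rw [coboundary_mulVec_apply] at hi
    simpa [hlt.le, sub_eq_zero] using hi
  · intro h
    funext ⟨⟨e, he⟩, i⟩
    rw [coboundary_mulVec_apply, Pi.zero_apply, sub_eq_zero]
    induction e using Sym2.ind with
    | _ u v =>
      rcases lt_or_gt_of_ne (G.ne_of_adj he) with hlt | hlt
      · simpa [hlt.le] using congrFun (h u v he hlt) i
      · simpa [hlt.le, Sym2.eq_swap (a := v)] using congrFun (h v u he.symm hlt) i

/-- Kernel characterization of the sheaf Laplacian: `Δ_F *ᵥ x = 0` iff for every edge
`e = {u, v}` of `G` (with `u < v`) the restricted signals agree: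
`F e u *ᵥ x_u = F e v *ᵥ x_v`. -/
theorem sheafLaplacian_kernel_iff {V : Type*} [Fintype V] [LinearOrder V]
    (G : SimpleGraph V) [DecidableRel G.Adj] (d : ℕ)
    (F : Sym2 V → V → Matrix (Fin d) (Fin d) ℝ) (x : V × Fin d → ℝ) :
    (sheafLaplacian G d F).mulVec x = 0 ↔
      ∀ u v : V, G.Adj u v → u < v →
        (F s(u, v) u).mulVec (fun i => x (u, i)) =
          (F s(u, v) v).mulVec (fun i => x (v, i)) := by
  rw [sheafLaplacian, ← conjTranspose_eq_transpose_of_trivial, conjTranspose_mul_self_mulVec_eq_zero]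
  exact coboundary_mulVec_eq_zero_iff G d F x
end
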